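/- Classical data compression with quantum side information: given a cq state ρ^{XB} = ∑_x P_X(x)|x⟩⟨x|⊗ρ_x, there exists a protocol using a shared random 2-universal hash function f: X → [2^R] in which Alice sends f(x) and Bob decodes via sequential measurements, such that the expected decoding error (over x ∼ P_X and the hash) is at most √(2ε) + ε, provided R ≥ H_max^ε(X) − I_H^ε(X:B)_ρ − log ε. -/

import Mathlib

noncomputable section
open scoped BigOperators ComplexOrder

/-- The ε-smooth max entropy, via the linear program minimizing `∑ x, lam x` subject to
`∑ x, P x * lam x ≥ 1 − ε` and `0 ≤ lam x ≤ 1`. -/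
def Hmax {X : Type*} [Fintype X] (P : X → ℝ) (ε : ℝ) : ℝ :=
  Real.logb 2 (sInf {s : ℝ | ∃ lam : X → ℝ,
    (∀ x, 0 ≤ lam x ∧ lam x ≤ 1) ∧ 1 - ε ≤ ∑ x, P x * lam x ∧ s = ∑ x, lam x})

/-- The hypothesis-testing divergence
`D_H^ε(ρ‖σ) = −log min{Tr[Tσ] : 0 ≤ T ≤ I, Tr[Tρ] ≥ 1 − ε}`. -/
def DH {n : Type*} [Fintype n] [DecidableEq n] (ε : ℝ) (ρ σ : Matrix n n ℂ) : ℝ :=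
  - Real.logb 2 (sInf {t : ℝ | ∃ T : Matrix n n ℂ, T.PosSemidef ∧ (1 - T).PosSemidef ∧
      1 - ε ≤ ((T * ρ).trace).re ∧ t = ((T * σ).trace).re})

/-- The cq state `ρ^{XB} = ∑ₓ P x |x⟩⟨x| ⊗ ρ x`. -/
def cqState {X : Type*} [Fintype X] [DecidableEq X] {d : ℕ}
    (P : X → ℝ) (ρ : X → Matrix (Fin d) (Fin d) ℂ) :
    Matrix (X × Fin d) (X × Fin d) ℂ :=
  fun p q => if p.1 = q.1 then (P p.1 : ℂ) * ρ p.1 p.2 q.2 else 0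

/-- The product of marginals `ρ^X ⊗ ρ^B` of the cq state. -/
def cqProdState {X : Type*} [Fintype X] [DecidableEq X] {d : ℕ}
    (P : X → ℝ) (ρ : X → Matrix (Fin d) (Fin d) ℂ) :
    Matrix (X × Fin d) (X × Fin d) ℂ :=
  fun p q => if p.1 = q.1 then (P p.1 : ℂ) * (∑ x, (P x : ℂ) * ρ x p.2 q.2) else 0

/-- The hypothesis-testing mutual information `I_H^ε(X:B)_ρ = D_H^ε(ρ^{XB}‖ρ^X⊗ρ^B)`. -/
def IH {X : Type*} [Fintype X] [DecidableEq X] {d : ℕ}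
    (ε : ℝ) (P : X → ℝ) (ρ : X → Matrix (Fin d) (Fin d) ℂ) : ℝ :=
  DH ε (cqState P ρ) (cqProdState P ρ)

section Matrices

variable {n : Type*} [Fintype n] [DecidableEq n]

lemma Matrix.PosSemidef.trace_mul_nonneg {A B : Matrix n n ℂ}
    (hA : A.PosSemidef) (hB : B.PosSemidef) : 0 ≤ ((A * B).trace).re := by
  open scoped MatrixOrder in
  obtain ⟨S, hS⟩ := CStarAlgebra.nonneg_iff_eq_star_mul_self.mp hA.nonneg
  rw [hS, Matrix.mul_assoc, Matrix.trace_mul_comm]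
  exact (Complex.le_def.mp (hB.mul_mul_conjTranspose_same S).trace_nonneg).1

lemma Matrix.PosDef.exists_inv_sqrt {C : Matrix n n ℂ} (hC : C.PosDef) :
    ∃ Y W : Matrix n n ℂ, Y.PosSemidef ∧ W.PosSemidef ∧ Y * W = 1 ∧ W * Y = 1 ∧ Y * Y = C := by
  open scoped MatrixOrder in
  have hY : CFC.sqrt C * CFC.sqrt C = C := CFC.sqrt_mul_sqrt_self C hC.posSemidef.nonneg
  have hps : (CFC.sqrt C).PosSemidef := Matrix.nonneg_iff_posSemidef.mp (CFC.sqrt_nonneg C)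
  have hu : IsUnit (CFC.sqrt C).det := by
    have h := (Matrix.isUnit_iff_isUnit_det _).mp hC.isUnit
    rw [← hY, Matrix.det_mul] at h
    exact isUnit_of_mul_isUnit_left h
  exact ⟨_, _, hps, hps.inv, Matrix.mul_nonsing_inv _ hu, Matrix.nonsing_inv_mul _ hu, hY⟩

/-- A quadratic lower bound for the collision overlap `Tr[A C^{-1/2} A C^{-1/2}]`. -/
lemma two_mul_trace_sub_le_trace_collision {A T Y W : Matrix n n ℂ} (hA : A.IsHermitian)
    (hT : T.IsHermitian) (hY : Y.IsHermitian) (hW : W.PosSemidef)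
    (hYW : Y * W = 1) (hWY : W * Y = 1) :
    2 * ((A * T).trace).re - ((Y * Y * (T * T)).trace).re ≤ ((W * A * W * A).trace).re := by
  have hZ : (A - Y * T * Y).IsHermitian := by
    unfold Matrix.IsHermitian
    simp [Matrix.conjTranspose_mul, hA.eq, hT.eq, hY.eq, Matrix.mul_assoc]
  have h1 : 0 ≤ ((((A - Y * T * Y) * W * (A - Y * T * Y)) * W).trace).re := by
    have := hW.mul_mul_conjTranspose_same (A - Y * T * Y)
    rw [hZ.eq] at this
    exact this.trace_mul_nonneg hW
  have h2 : 0 ≤ (((Y * T - T * Y) * (Y * T - T * Y).conjTranspose).trace).re :=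
    (Complex.le_def.mp (Matrix.posSemidef_self_mul_conjTranspose (Y * T - T * Y)).trace_nonneg).1
  have e1 : ((A - Y * T * Y) * W * (A - Y * T * Y)) * W
      = A * W * A * W - A * T - Y * T * A * W + Y * T * Y * T := by
    have hWY' : ∀ M : Matrix n n ℂ, W * (Y * M) = M := fun M => by
      rw [← Matrix.mul_assoc, hWY, Matrix.one_mul]
    simp only [Matrix.sub_mul, Matrix.mul_sub, Matrix.mul_assoc, hYW, hWY', Matrix.mul_one]
    abel
  have e2 : (Y * T * A * W).trace = (A * T).trace := by
    rw [Matrix.mul_assoc, Matrix.mul_assoc, Matrix.trace_mul_comm, Matrix.mul_assoc,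
      Matrix.mul_assoc, hWY, Matrix.mul_one, Matrix.trace_mul_comm]
  have e3 : (W * A * W * A).trace = (A * W * A * W).trace := by
    rw [Matrix.trace_mul_comm]; simp only [Matrix.mul_assoc]
  have e4 : (Y * T - T * Y) * (Y * T - T * Y).conjTranspose
      = Y * T * T * Y - Y * T * Y * T - T * Y * T * Y + T * Y * Y * T := by
    simp only [Matrix.conjTranspose_sub, Matrix.conjTranspose_mul, hT.eq, hY.eq,
      Matrix.sub_mul, Matrix.mul_sub, Matrix.mul_assoc]
    abel
  have e5 : (Y * T * T * Y).trace = (Y * Y * (T * T)).trace := by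
    rw [Matrix.trace_mul_comm]; simp only [Matrix.mul_assoc]
  have e6 : (T * Y * T * Y).trace = (Y * T * Y * T).trace := by
    rw [Matrix.trace_mul_comm]; simp only [Matrix.mul_assoc]
  have e7 : (T * Y * Y * T).trace = (Y * Y * (T * T)).trace := by
    rw [Matrix.mul_assoc, Matrix.mul_assoc, Matrix.trace_mul_comm]; simp only [Matrix.mul_assoc]
  rw [e1] at h1
  rw [e4] at h2
  simp only [Matrix.trace_add, Matrix.trace_sub, Complex.add_re, Complex.sub_re, e2, e5, e6, e7]
    at h1 h2
  rw [e3]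
  linarith

lemma Matrix.PosSemidef.sub_mul_self {T : Matrix n n ℂ} (hT : T.PosSemidef)
    (hT1 : (1 - T).PosSemidef) : (T - T * T).PosSemidef := by
  have h1 := hT1.mul_mul_conjTranspose_same T
  have h2 := hT.mul_mul_conjTranspose_same (1 - T)
  rw [hT.1.eq] at h1
  rw [hT1.1.eq] at h2
  convert h1.add h2 using 1
  noncomm_ring

/-- The (regularized) pretty good measurement for the positive operators `A x`, `x ∈ s`. -/
lemma exists_prettyGoodMeasurement {X : Type*} [Fintype X] [DecidableEq X]
    (A : X → Matrix n n ℂ) (hA : ∀ x, (A x).PosSemidef) {δ : ℝ} (hδ : 0 < δ) (s : Finset X) :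
    ∃ D : X → Matrix n n ℂ, (∀ x, (D x).PosSemidef) ∧ (1 - ∑ x, D x).PosSemidef ∧
      ∀ x ∈ s, ∀ (T : Matrix n n ℂ) (μ : ℝ), T.PosSemidef → (1 - T).PosSemidef →
        2 * μ * ((A x * T).trace).re
            - μ ^ 2 * (δ * (T.trace).re + ∑ y ∈ s, ((A y * T).trace).re)
          ≤ ((D x * A x).trace).re := by
  have hsum : (∑ y ∈ s, A y).PosSemidef := Matrix.posSemidef_sum s fun y _ => hA y
  have hC : (δ • (1 : Matrix n n ℂ) + ∑ y ∈ s, A y).PosDef :=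
    (Matrix.PosDef.one.smul hδ).add_posSemidef hsum
  obtain ⟨Y, W, hY, hW, hYW, hWY, hYY⟩ := hC.exists_inv_sqrt
  refine ⟨fun x => if x ∈ s then W * A x * W else 0, fun x => ?_, ?_, fun x hx T μ hT hT1 => ?_⟩
  · dsimp only
    split_ifs
    · simpa [hW.1.eq] using (hA x).mul_mul_conjTranspose_same W
    · exact .zero
  · have h : 1 - ∑ x, (if x ∈ s then W * A x * W else 0) = δ • (W * W) := by
      rw [Finset.sum_ite_mem, Finset.univ_inter, ← Finset.sum_mul, ← Finset.mul_sum,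
        eq_sub_of_add_eq' hYY.symm]
      have : W * (Y * Y) * W = 1 := by
        rw [← Matrix.mul_assoc, hWY, Matrix.one_mul, hYW]
      rw [Matrix.mul_sub, Matrix.sub_mul, this]
      simp
    rw [h]
    have := Matrix.posSemidef_self_mul_conjTranspose W
    rw [hW.1.eq] at this
    exact this.smul hδ.le
  · have hμT : (μ • T).IsHermitian := by
      unfold Matrix.IsHermitian
      simp [Matrix.conjTranspose_smul, hT.1.eq]
    have h1 := two_mul_trace_sub_le_trace_collision (hA x).1 hμT hY.1 hW hYW hWY
    have h2 := hC.posSemidef.trace_mul_nonneg (hT.sub_mul_self hT1)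
    have e : (((δ • (1 : Matrix n n ℂ) + ∑ y ∈ s, A y) * T).trace).re
        = δ * (T.trace).re + ∑ y ∈ s, ((A y * T).trace).re := by
      simp [Matrix.add_mul, Finset.sum_mul, Matrix.trace_sum, Matrix.trace_add]
    rw [Matrix.mul_sub, Matrix.trace_sub, Complex.sub_re, e] at h2
    rw [hYY] at h1
    simp only [Matrix.mul_smul, Matrix.smul_mul, Matrix.trace_smul, Complex.smul_re, smul_eq_mul]
      at h1
    simp only [if_pos hx]
    nlinarith [sq_nonneg μ]

end Matrices

lemma card_filter_apply_eq_mul_le {X M : Type*} [Fintype X] [DecidableEq X] [Fintype M]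
    [DecidableEq M] {x x' : X} (h : x ≠ x') :
    (Finset.univ.filter fun f : X → M => f x = f x').card * Fintype.card M
      ≤ Fintype.card (X → M) := by
  rw [← Finset.card_univ (α := M), ← Finset.card_product, ← Finset.card_univ]
  refine Finset.card_le_card_of_injOn (fun p => Function.update p.1 x p.2) (by simp) ?_
  rintro ⟨f, a⟩ hf ⟨g, b⟩ hg hfg
  simp only [Finset.coe_product, Finset.coe_filter, Finset.mem_univ, true_and, Set.mem_prod,
    Set.mem_ofPred_eq, Finset.coe_univ, Set.mem_univ, and_true] at hf hg
  have hfun := fun z => congrFun hfg z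
  have hne : ∀ z, z ≠ x → f z = g z := fun z hz => by simpa [hz] using hfun z
  have hab : a = b := by simpa using hfun x
  have hfx : f x = g x := by rw [hf, hg, hne x' h.symm]
  refine Prod.ext (funext fun z => ?_) hab
  by_cases hz : z = x
  · simpa [hz] using hfx
  · exact hne z hz

lemma exists_quadratic_ge {a b θ : ℝ} (ha : 0 ≤ a) (hb : 0 ≤ b) (hθ : 0 < θ) :
    ∃ μ : ℝ, 0 ≤ 2 * μ * a - μ ^ 2 * (a + b) ∧
      a - (θ + a * b / θ) / 4 ≤ 2 * μ * a - μ ^ 2 * (a + b) := by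
  rcases (add_nonneg ha hb).eq_or_lt with h | h
  · have ha0 : a = 0 := by linarith
    refine ⟨0, by simp, ?_⟩
    simp [ha0]; positivity
  · have e : 2 * (a / (a + b)) * a - (a / (a + b)) ^ 2 * (a + b) = a ^ 2 / (a + b) := by
      field_simp; ring
    refine ⟨a / (a + b), e ▸ by positivity, e ▸ ?_⟩
    have e2 : a ^ 2 / (a + b) = a - a * b / (a + b) := by field_simp; ring
    rw [e2]
    have : a * b / (a + b) ≤ (θ + a * b / θ) / 4 := by
      have e3 : (θ + a * b / θ) / 4 = (θ ^ 2 + a * b) / (4 * θ) := by field_simp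
      rw [e3, div_le_div_iff₀ h (by positivity)]
      have hq : 0 ≤ a * b := mul_nonneg ha hb
      refine le_of_sq_le_sq ?_ (by positivity)
      have h1 : 4 * (a * b) ≤ (a + b) ^ 2 := by nlinarith [sq_nonneg (a - b)]
      have h2 : 4 * (a * b) * θ ^ 2 ≤ (θ ^ 2 + a * b) ^ 2 := by
        nlinarith [sq_nonneg (θ ^ 2 - a * b)]
      nlinarith [mul_le_mul h2 h1 (by positivity) (by positivity)]
    linarith

lemma exists_weights {X : Type*} [Fintype X] {P s b lam : X → ℝ} {ε : ℝ}
    (hP0 : ∀ x, 0 ≤ P x) (hP1 : ∑ x, P x = 1)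
    (hs0 : ∀ x, 0 ≤ s x) (hs1 : ∀ x, s x ≤ 1) (hb : ∀ x, 0 ≤ b x)
    (hlam : ∀ x, 0 ≤ lam x ∧ lam x ≤ 1) (hPlam : 1 - ε ≤ ∑ x, P x * lam x)
    (hPs : 1 - ε ≤ ∑ x, P x * s x) (hε0 : 0 < ε) (hε1 : ε ≤ 1 / 2) (hL : 0 < ∑ x, lam x)
    (hLb : (∑ x, lam x) * ∑ x, P x * b x ≤ 2 * ε) :
    ∃ μ : X → ℝ, 1 - Real.sqrt (2 * ε) - ε
      ≤ ∑ x, (2 * μ x * (P x * s x) - μ x ^ 2 * (P x * s x + b x)) := by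
  set L := ∑ x, lam x with hLdef
  set r := Real.sqrt (2 * ε) with hr
  have hr0 : 0 < r := Real.sqrt_pos.mpr (by linarith)
  have hr2 : r ^ 2 = 2 * ε := Real.sq_sqrt (by linarith)
  have hθ : 0 < r / L := div_pos hr0 hL
  choose μ hμ0 hμ using fun x => exists_quadratic_ge (mul_nonneg (hP0 x) (hs0 x)) (hb x) hθ
  refine ⟨μ, ?_⟩
  have hx : ∀ x, P x * lam x + P x * s x - P x - (r / L) / 4 * lam x - L / (4 * r) * (P x * b x)
      ≤ 2 * μ x * (P x * s x) - μ x ^ 2 * (P x * s x + b x) := by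
    intro x
    have h1 : lam x * (P x * s x - (r / L + P x * s x * b x / (r / L)) / 4)
        ≤ 2 * μ x * (P x * s x) - μ x ^ 2 * (P x * s x + b x) :=
      (mul_le_mul_of_nonneg_left (hμ x) (hlam x).1).trans
        (mul_le_of_le_one_left (hμ0 x) (hlam x).2)
    refine le_trans ?_ h1
    have h2 : 0 ≤ P x * ((1 - lam x) * (1 - s x)) :=
      mul_nonneg (hP0 x) (mul_nonneg (by linarith [(hlam x).2]) (by linarith [hs1 x]))
    have h3 : lam x * s x ≤ 1 := mul_le_one₀ (hlam x).2 (hs0 x) (hs1 x)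
    have h4 : lam x * (P x * s x * b x / (r / L)) / 4 ≤ L / (4 * r) * (P x * b x) := by
      have e : lam x * (P x * s x * b x / (r / L)) / 4
          = (lam x * s x) * (L / (4 * r) * (P x * b x)) := by field_simp
      rw [e]
      have := mul_nonneg (hP0 x) (hb x)
      exact mul_le_of_le_one_left (by positivity) h3
    linarith
  refine le_trans ?_ (Finset.sum_le_sum fun x _ => hx x)
  simp only [Finset.sum_add_distrib, Finset.sum_sub_distrib, ← Finset.mul_sum, hP1, ← hLdef]
  have h5 : r / L / 4 * L = r / 4 := by field_simp
  have h6 : L / (4 * r) * ∑ x, P x * b x ≤ r / 4 := by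
    rw [div_mul_eq_mul_div, div_le_iff₀ (by positivity)]
    linarith
  have hr1 : r ≤ 1 := by nlinarith
  nlinarith

lemma submatrix_one_sub_posSemidef {X : Type*} [DecidableEq X] {d : ℕ}
    {T : Matrix (X × Fin d) (X × Fin d) ℂ} (hT : (1 - T).PosSemidef) (x : X) :
    (1 - T.submatrix (Prod.mk x) (Prod.mk x)).PosSemidef := by
  have h := hT.submatrix (Prod.mk x)
  rwa [Matrix.submatrix_sub, Pi.sub_apply, Pi.sub_apply,
    Matrix.submatrix_one _ (Prod.mk_right_injective x)] at h

section Protocol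

variable {X : Type*} [Fintype X] [DecidableEq X]

lemma trace_mul_cqState {d : ℕ} (P : X → ℝ) (ρ : X → Matrix (Fin d) (Fin d) ℂ)
    (T : Matrix (X × Fin d) (X × Fin d) ℂ) :
    ((T * cqState P ρ).trace).re
      = ∑ x, P x * ((T.submatrix (Prod.mk x) (Prod.mk x) * ρ x).trace).re := by
  simp only [Matrix.trace, Matrix.diag_apply, Matrix.mul_apply, cqState, Fintype.sum_prod_type,
    mul_ite, mul_zero, Matrix.submatrix_apply, Complex.re_sum, Finset.mul_sum]
  refine Finset.sum_congr rfl fun x _ => Finset.sum_congr rfl fun i _ => ?_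
  rw [Finset.sum_eq_single x (by intro b _ hb; simp [hb]) (by simp)]
  refine Finset.sum_congr rfl fun j _ => ?_
  rw [if_pos rfl, mul_left_comm, Complex.re_ofReal_mul]

lemma cqProdState_eq_cqState {d : ℕ} (P : X → ℝ) (ρ : X → Matrix (Fin d) (Fin d) ℂ) :
    cqProdState P ρ = cqState P fun _ => ∑ y, (P y : ℂ) • ρ y := by
  ext p q
  simp [cqProdState, cqState, Matrix.sum_apply]

/-- Averaged over all hash functions, the contribution of the bucket of `x` to a nonnegative
weight `w` is at most `w x` plus a fraction `1 / |M|` of the total weight. -/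
lemma sum_sum_filter_hash_le {M : Type*} [Fintype M] [DecidableEq M] [Nonempty M]
    {w : X → ℝ} (hw : ∀ y, 0 ≤ w y) (x : X) :
    ∑ f : X → M, ∑ y with f y = f x, w y
      ≤ Fintype.card (X → M) * (w x + (Fintype.card M : ℝ)⁻¹ * ∑ y, w y) := by
  have hM : (0 : ℝ) < Fintype.card M := by exact_mod_cast Fintype.card_pos
  have key : ∀ y, (((Finset.univ.filter fun f : X → M => f y = f x).card : ℝ)) * w y
      ≤ Fintype.card (X → M) * ((if y = x then w y else 0) + (Fintype.card M : ℝ)⁻¹ * w y) := by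
    intro y
    rcases eq_or_ne y x with rfl | h
    · simp only [Finset.filter_true, Finset.card_univ, if_true]
      gcongr
      have := hw y
      have : 0 ≤ (Fintype.card M : ℝ)⁻¹ * w y := by positivity
      linarith
    · have h1 : (((Finset.univ.filter fun f : X → M => f y = f x).card : ℝ)) * Fintype.card M
          ≤ Fintype.card (X → M) := by exact_mod_cast card_filter_apply_eq_mul_le h
      rw [if_neg h, zero_add, ← mul_assoc, ← div_eq_mul_inv]
      exact mul_le_mul_of_nonneg_right ((le_div_iff₀ hM).mpr h1) (hw y)
  calc ∑ f : X → M, ∑ y with f y = f x, w y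
      = ∑ y, (((Finset.univ.filter fun f : X → M => f y = f x).card : ℝ)) * w y := by
        simp only [Finset.sum_filter]
        rw [Finset.sum_comm]
        refine Finset.sum_congr rfl fun y _ => ?_
        rw [← Finset.sum_filter, Finset.sum_const, nsmul_eq_mul]
    _ ≤ _ := Finset.sum_le_sum fun y _ => key y
    _ = _ := by
        rw [← Finset.mul_sum, Finset.sum_add_distrib, Finset.sum_ite_eq' Finset.univ x w,
          if_pos (Finset.mem_univ x), ← Finset.mul_sum]

/-- The decoder applying the pretty good measurement of the received bucket, with its success
probability averaged over all hash functions bounded below in terms of the tests `T x`. -/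
lemma exists_decoder {n : Type*} [Fintype n] [DecidableEq n]
    {M : Type*} [Fintype M] [DecidableEq M] [Nonempty M]
    {P : X → ℝ} (hP0 : ∀ x, 0 ≤ P x) {ρ : X → Matrix n n ℂ} (hρ : ∀ x, (ρ x).PosSemidef)
    {δ : ℝ} (hδ : 0 < δ) {T : X → Matrix n n ℂ} (hT : ∀ x, (T x).PosSemidef)
    (hT1 : ∀ x, (1 - T x).PosSemidef) (μ : X → ℝ) :
    ∃ D : (X → M) → M → X → Matrix n n ℂ,
      (∀ f m, (∀ x, (D f m x).PosSemidef) ∧ (1 - ∑ x, D f m x).PosSemidef) ∧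
      Fintype.card (X → M) * ∑ x, (2 * μ x * (P x * ((T x * ρ x).trace).re)
          - μ x ^ 2 * (P x * ((T x * ρ x).trace).re + ((Fintype.card M : ℝ)⁻¹ *
              ((T x * ∑ y, (P y : ℂ) • ρ y).trace).re + δ * Fintype.card n)))
        ≤ ∑ f, ∑ x, P x * ((D f (f x) x * ρ x).trace).re := by
  have hA : ∀ x, ((P x : ℂ) • ρ x).PosSemidef := fun x =>
    (hρ x).smul (by exact_mod_cast hP0 x)
  choose D hD hD1 hDs using fun s => exists_prettyGoodMeasurement _ hA hδ s
  refine ⟨fun f m => D {y | f y = m}, fun f m => ⟨hD _, hD1 _⟩, ?_⟩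
  have htr : ∀ x y, (((P y : ℂ) • ρ y * T x).trace).re = P y * ((T x * ρ y).trace).re := by
    intro x y
    rw [Matrix.smul_mul, Matrix.trace_smul, smul_eq_mul, Complex.re_ofReal_mul,
      Matrix.trace_mul_comm]
  have htr' : ∀ B x, (((B : Matrix n n ℂ) * (P x : ℂ) • ρ x).trace).re
      = P x * ((B * ρ x).trace).re := by
    intro B x
    rw [Matrix.mul_smul, Matrix.trace_smul, smul_eq_mul, Complex.re_ofReal_mul]
  have htot : ∀ x, ((T x * ∑ y, (P y : ℂ) • ρ y).trace).re
      = ∑ y, P y * ((T x * ρ y).trace).re := by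
    intro x
    rw [Finset.mul_sum, Matrix.trace_sum, Complex.re_sum]
    exact Finset.sum_congr rfl fun y _ => htr' _ _
  have hTn : ∀ x, ((T x).trace).re ≤ Fintype.card n := by
    intro x
    have := (Complex.le_def.mp (hT1 x).trace_nonneg).1
    simpa [Matrix.trace_sub] using this
  rw [Finset.sum_comm, Finset.mul_sum]
  refine Finset.sum_le_sum fun x _ => ?_
  have hw : ∀ y, 0 ≤ P y * ((T x * ρ y).trace).re := fun y =>
    mul_nonneg (hP0 y) ((hT x).trace_mul_nonneg (hρ y))
  have hcoll := sum_sum_filter_hash_le (M := M) hw x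
  have hsucc : ∀ f : X → M, 2 * μ x * (P x * ((T x * ρ x).trace).re)
      - μ x ^ 2 * (δ * Fintype.card n + ∑ y with f y = f x, P y * ((T x * ρ y).trace).re)
      ≤ P x * ((D {y | f y = f x} x * ρ x).trace).re := by
    intro f
    have h := hDs {y | f y = f x} x (by simp) (T x) (μ x) (hT x) (hT1 x)
    simp only [htr, htr'] at h
    refine le_trans ?_ h
    have := mul_le_mul_of_nonneg_left (mul_le_mul_of_nonneg_left (hTn x) hδ.le)
      (sq_nonneg (μ x))
    linarith
  refine le_trans ?_ (Finset.sum_le_sum fun f _ => hsucc f)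
  rw [Finset.sum_sub_distrib, ← Finset.mul_sum (a := μ x ^ 2), Finset.sum_add_distrib, htot]
  simp only [Finset.sum_const, Finset.card_univ, nsmul_eq_mul]
  nlinarith [mul_le_mul_of_nonneg_left hcoll (sq_nonneg (μ x))]

end Protocol

lemma card_filter_apply_eq_div_le {X M : Type*} [Fintype X] [DecidableEq X] [Fintype M]
    [DecidableEq M] [Nonempty M] {N : ℕ} (e : Fin N ≃ (X → M)) {x x' : X} (h : x ≠ x') :
    ((Finset.univ.filter fun j : Fin N => e j x = e j x').card : ℝ) / N
      ≤ 1 / Fintype.card M := by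
  have hN : Fintype.card (X → M) = N := by simpa using (Fintype.card_congr e).symm
  have hc : (Finset.univ.filter fun j : Fin N => e j x = e j x').card
      = (Finset.univ.filter fun f : X → M => f x = f x').card :=
    Finset.card_equiv e (by simp)
  have h1 := card_filter_apply_eq_mul_le (M := M) h
  rw [hN, ← hc] at h1
  have hN0 : 0 < N := hN ▸ Fintype.card_pos
  rw [div_le_div_iff₀ (by exact_mod_cast hN0) (by exact_mod_cast Fintype.card_pos), one_mul]
  exact_mod_cast h1

/-- classical data compression with quantum side information: given a cq
state `ρ^{XB}`, there is a protocol based on a shared `2`-universal hash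
`f : X → [2^R]` (Alice sends `f x`, Bob decodes with a measurement depending on the hash
value and the hash function) whose expected decoding error is at most `√(2ε) + ε`,
provided `R ≥ H_max^ε(X) − I_H^ε(X:B) − log ε`. -/
theorem cdc_qsi
    {X : Type*} [Fintype X] [DecidableEq X] {d : ℕ}
    (P : X → ℝ) (hP0 : ∀ x, 0 ≤ P x) (hP1 : (∑ x, P x) = 1)
    (ρ : X → Matrix (Fin d) (Fin d) ℂ)
    (hρ : ∀ x, (ρ x).PosSemidef ∧ (ρ x).trace = 1)
    (ε : ℝ) (hε0 : 0 < ε) (hε1 : ε < 1)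
    (R : ℕ)
    (hR : Hmax P ε - IH ε P ρ - Real.logb 2 ε ≤ (R : ℝ)) :
    ∃ (N : ℕ), 0 < N ∧
    ∃ (f : Fin N → X → Fin (2 ^ R))
      (D : Fin N → Fin (2 ^ R) → X → Matrix (Fin d) (Fin d) ℂ),
      -- the hash family is 2-universal
      (∀ x x', x ≠ x' →
        ((Finset.univ.filter (fun j : Fin N => f j x = f j x')).card : ℝ) / (N : ℝ)
          ≤ 1 / ((2 : ℝ) ^ R)) ∧
      -- for each hash function and received hash value, Bob's decoder is a sub-POVM
      (∀ j m, (∀ x, (D j m x).PosSemidef) ∧ (1 - ∑ x, D j m x).PosSemidef) ∧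
      -- the expected decoding error over `x ∼ P` and the shared hash is small
      (1 / (N : ℝ)) * (∑ j, ∑ x, P x * (1 - ((D j (f j x) x * ρ x).trace).re))
        ≤ Real.sqrt (2 * ε) + ε := by
  classical
  let e : Fin (Fintype.card (X → Fin (2 ^ R))) ≃ (X → Fin (2 ^ R)) := (Fintype.equivFin _).symm
  have hN : (0 : ℝ) < Fintype.card (X → Fin (2 ^ R)) := by exact_mod_cast Fintype.card_pos
  suffices H : ∃ D : (X → Fin (2 ^ R)) → Fin (2 ^ R) → X → Matrix (Fin d) (Fin d) ℂ,
      (∀ f m, (∀ x, (D f m x).PosSemidef) ∧ (1 - ∑ x, D f m x).PosSemidef) ∧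
      Fintype.card (X → Fin (2 ^ R)) * (1 - Real.sqrt (2 * ε) - ε)
        ≤ ∑ f, ∑ x, P x * ((D f (f x) x * ρ x).trace).re by
    obtain ⟨D, hD, hD'⟩ := H
    refine ⟨_, Fintype.card_pos, fun j => e j, fun j => D (e j), fun x x' h => ?_,
      fun j m => hD _ m, ?_⟩
    · simpa using card_filter_apply_eq_div_le e h
    · rw [e.sum_comp fun f : X → Fin (2 ^ R) =>
        ∑ x, P x * (1 - ((D f (f x) x * ρ x).trace).re)]
      simp only [mul_sub, mul_one, Finset.sum_sub_distrib, hP1, Finset.sum_const,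
        Finset.card_univ, nsmul_eq_mul]
      rw [← mul_sub, one_div_mul_eq_div, div_le_iff₀ hN]
      linarith
  rcases le_or_gt (1 / 2) ε with hε | hε
  · refine ⟨fun _ _ _ => 0, fun _ _ => ⟨fun _ => .zero, by simpa using Matrix.PosSemidef.one⟩, ?_⟩
    have : 1 ≤ Real.sqrt (2 * ε) := Real.one_le_sqrt.mpr (by linarith)
    simp only [Matrix.zero_mul, Matrix.trace_zero, Complex.zero_re, mul_zero,
      Finset.sum_const_zero]
    exact mul_nonpos_of_nonneg_of_nonpos hN.le (by linarith)
  have hρB : (∑ y, (P y : ℂ) • ρ y).PosSemidef := Matrix.posSemidef_sum _ fun y _ =>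
    (hρ y).1.smul (by exact_mod_cast hP0 y)
  have hPle : ∀ x, P x ≤ 1 := fun x =>
    hP1 ▸ Finset.single_le_sum (fun y _ => hP0 y) (Finset.mem_univ x)
  unfold IH DH Hmax at hR
  set S₁ := {s : ℝ | ∃ lam : X → ℝ,
    (∀ x, 0 ≤ lam x ∧ lam x ≤ 1) ∧ 1 - ε ≤ ∑ x, P x * lam x ∧ s = ∑ x, lam x} with hS₁
  set S₂ := {t : ℝ | ∃ T : Matrix (X × Fin d) (X × Fin d) ℂ, T.PosSemidef ∧ (1 - T).PosSemidef ∧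
      1 - ε ≤ ((T * cqState P ρ).trace).re ∧ t = ((T * cqProdState P ρ).trace).re} with hS₂
  have hne₁ : S₁.Nonempty := ⟨_, fun _ => 1, by simp, by simp [hP1, hε0.le], rfl⟩
  have hne₂ : S₂.Nonempty := by
    refine ⟨_, 1, .one, by simpa using Matrix.PosSemidef.zero, ?_, rfl⟩
    rw [trace_mul_cqState]
    simp [Matrix.submatrix_one _ (Prod.mk_right_injective _), (hρ _).2, hP1, hε0.le]
  have hle₁ : ∀ s ∈ S₁, 1 - ε ≤ s := by
    rintro s ⟨lam, hlam, hPlam, rfl⟩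
    exact hPlam.trans (Finset.sum_le_sum fun x _ => mul_le_of_le_one_left (hlam x).1 (hPle x))
  have hle₂ : ∀ t ∈ S₂, 0 ≤ t := by
    rintro t ⟨T, hT, -, -, rfl⟩
    rw [cqProdState_eq_cqState, trace_mul_cqState]
    exact Finset.sum_nonneg fun x _ =>
      mul_nonneg (hP0 x) ((hT.submatrix _).trace_mul_nonneg hρB)
  have hH : 0 < sInf S₁ := lt_of_lt_of_le (by linarith) (le_csInf hne₁ hle₁)
  have hB : 0 ≤ sInf S₂ := le_csInf hne₂ hle₂
  have hrate : sInf S₁ * sInf S₂ ≤ ε * 2 ^ R := by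
    rcases hB.eq_or_lt with h0 | h0
    · rw [← h0, mul_zero]; positivity
    · rw [sub_neg_eq_add, ← Real.logb_mul hH.ne' h0.ne', ← Real.logb_div (by positivity) hε0.ne',
        Real.logb_le_iff_le_rpow (by norm_num) (by positivity), Real.rpow_natCast,
        div_le_iff₀ hε0] at hR
      linarith
  obtain ⟨L, ⟨lam, hlam, hPlam, rfl⟩, hL⟩ :=
    exists_lt_of_csInf_lt hne₁ (show sInf S₁ < 5 / 4 * sInf S₁ by linarith)
  obtain ⟨β, ⟨T, hT, hT1, hTs, hβ'⟩, hβ⟩ :=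
    exists_lt_of_csInf_lt hne₂ (show sInf S₂ < sInf S₂ + ε / (4 * sInf S₁) by
      linarith [show 0 < ε / (4 * sInf S₁) by positivity])
  have hL0 : 0 < ∑ x, lam x := lt_of_lt_of_le (by linarith) (hle₁ _ ⟨lam, hlam, hPlam, rfl⟩)
  set δ := ε / (4 * sInf S₁ * (d + 1)) with hδdef
  have hδ : 0 < δ := by positivity
  let Q : X → Matrix (Fin d) (Fin d) ℂ := fun x => T.submatrix (Prod.mk x) (Prod.mk x)
  have hQ : ∀ x, (Q x).PosSemidef := fun x => hT.submatrix _
  have hQ1 : ∀ x, (1 - Q x).PosSemidef := submatrix_one_sub_posSemidef hT1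
  rw [trace_mul_cqState] at hTs
  rw [cqProdState_eq_cqState, trace_mul_cqState] at hβ'
  have hbsum : ∑ x, P x * ((Fintype.card (Fin (2 ^ R)) : ℝ)⁻¹ *
      ((Q x * ∑ y, (P y : ℂ) • ρ y).trace).re + δ * Fintype.card (Fin d))
      = (2 ^ R)⁻¹ * β + δ * d := by
    simp only [mul_add, Finset.sum_add_distrib, ← Finset.sum_mul, hP1, one_mul, Fintype.card_fin,
      Nat.cast_pow, Nat.cast_ofNat, hβ', Finset.mul_sum, Q]
    congr 1
    exact Finset.sum_congr rfl fun x _ => mul_left_comm _ _ _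
  obtain ⟨μ, hμ⟩ := exists_weights (s := fun x => ((Q x * ρ x).trace).re)
    (b := fun x => (Fintype.card (Fin (2 ^ R)) : ℝ)⁻¹ *
      ((Q x * ∑ y, (P y : ℂ) • ρ y).trace).re + δ * Fintype.card (Fin d))
    hP0 hP1 (fun x => (hQ x).trace_mul_nonneg (hρ x).1)
    (fun x => by
      have := (hQ1 x).trace_mul_nonneg (hρ x).1
      rw [Matrix.sub_mul, Matrix.one_mul, Matrix.trace_sub, (hρ x).2] at this
      simpa using this)
    (fun x => by
      have := (hQ x).trace_mul_nonneg hρB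
      positivity)
    hlam hPlam hTs hε0 hε.le hL0 (by
      rw [hbsum]
      have h1 : ((2 : ℝ) ^ R)⁻¹ * β ≤ ε / sInf S₁ + ε / (4 * sInf S₁) := by
        have hK : ((2 : ℝ) ^ R)⁻¹ ≤ 1 := inv_le_one_of_one_le₀ (one_le_pow₀ (by norm_num))
        have hq : 0 ≤ ε / (4 * sInf S₁) := by positivity
        have hB' : ((2 : ℝ) ^ R)⁻¹ * sInf S₂ ≤ ε / sInf S₁ := by
          rw [le_div_iff₀ hH, inv_mul_eq_div, div_mul_eq_mul_div, div_le_iff₀ (by positivity)]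
          linarith
        calc ((2 : ℝ) ^ R)⁻¹ * β ≤ ((2 : ℝ) ^ R)⁻¹ * (sInf S₂ + ε / (4 * sInf S₁)) := by gcongr
          _ = ((2 : ℝ) ^ R)⁻¹ * sInf S₂ + ((2 : ℝ) ^ R)⁻¹ * (ε / (4 * sInf S₁)) := mul_add _ _ _
          _ ≤ _ := add_le_add hB' (mul_le_of_le_one_left hq hK)
      have h2 : δ * d ≤ ε / (4 * sInf S₁) := by
        rw [hδdef, div_mul_eq_mul_div, div_le_div_iff₀ (by positivity) (by positivity)]
        have : 0 ≤ ε * (4 * sInf S₁) := by positivity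
        nlinarith
      calc (∑ x, lam x) * ((2 ^ R)⁻¹ * β + δ * d)
          ≤ (∑ x, lam x) * (ε / sInf S₁ + ε / (4 * sInf S₁) + ε / (4 * sInf S₁)) := by
            gcongr
        _ ≤ 5 / 4 * sInf S₁ * (ε / sInf S₁ + ε / (4 * sInf S₁) + ε / (4 * sInf S₁)) := by
            gcongr
        _ = 15 / 8 * ε := by field_simp; ring
        _ ≤ 2 * ε := by linarith)
  obtain ⟨D, hD, hD'⟩ := exists_decoder (M := Fin (2 ^ R)) hP0 (fun x => (hρ x).1) hδ hQ hQ1 μ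
  exact ⟨D, hD, (mul_le_mul_of_nonneg_left hμ hN.le).trans hD'⟩
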